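/- We have |G| = 1 + 2·j_G + Σ_{i=1}^{3} (n_i − 1). -/

import Mathlib

/-- The root of unity `exp (2πi q)` with `q` rational equals `1` exactly when `q` is an integer. -/
lemma exp_two_pi_I_mul_ratCast_eq_one_iff (q : ℚ) :
    Complex.exp (2 * Real.pi * Complex.I * (q : ℂ)) = 1 ↔ ∃ n : ℤ, q = n := by
  rw [Complex.exp_eq_one_iff]
  refine exists_congr fun n => ?_
  rw [mul_comm (n : ℂ), mul_right_inj' Complex.two_pi_I_ne_zero]
  exact_mod_cast Iff.rfl

/-- The only integer in `[0, 1)` is `0`. -/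
lemma eq_zero_of_eq_intCast {q : ℚ} (h0 : 0 ≤ q) (h1 : q < 1) {n : ℤ} (h : q = n) : q = 0 := by
  subst h
  have h0' : 0 ≤ n := by exact_mod_cast h0
  have h1' : n < 1 := by exact_mod_cast h1
  have : n = 0 := by omega
  simp [this]

/-- Three rationals in `[0, 1)` with integral sum either all vanish, or exactly one vanishes,
or none vanishes and the sum is `1` or `2`; stated through indicator functions. -/
lemma indicator_count_of_sum_eq_intCast {x : Fin 3 → ℚ} (h0 : ∀ j, 0 ≤ x j) (h1 : ∀ j, x j < 1)
    {n : ℤ} (h : ∑ j, x j = n) :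
    (1 : ℤ) = (if x = 0 then 1 else 0)
      + (if ∑ j, x j = 1 ∧ ∀ i, x i ≠ 0 then 1 else 0)
      + (if ∑ j, x j = 2 ∧ ∀ i, x i ≠ 0 then 1 else 0)
      + ∑ i, ((if x i = 0 then 1 else 0) - (if x = 0 then 1 else 0)) := by
  have hx : x = 0 ↔ x 0 = 0 ∧ x 1 = 0 ∧ x 2 = 0 := by
    simp [funext_iff, Fin.forall_fin_succ]
  simp only [hx, Fin.forall_fin_succ, Fin.sum_univ_three, Fin.succ_zero_eq_one,
    Fin.succ_one_eq_two, IsEmpty.forall_iff, and_true] at h ⊢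
  have z0 := fun k : x 0 = n => eq_zero_of_eq_intCast (h0 0) (h1 0) k
  have z1 := fun k : x 1 = n => eq_zero_of_eq_intCast (h0 1) (h1 1) k
  have z2 := fun k : x 2 = n => eq_zero_of_eq_intCast (h0 2) (h1 2) k
  by_cases c0 : x 0 = 0 <;> by_cases c1 : x 1 = 0 <;> by_cases c2 : x 2 = 0 <;>
    simp only [c0, c1, c2, zero_add, add_zero] at h z0 z1 z2 ⊢ <;> simp_all
  have hpos : (0 : ℚ) < n := by
    rw [← h]
    have := lt_of_le_of_ne (h0 0) (Ne.symm c0)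
    linarith [h0 1, h0 2]
  have hlt : (n : ℚ) < 3 := by rw [← h]; linarith [h1 0, h1 1, h1 2]
  have hpos' : 0 < n := by exact_mod_cast hpos
  have hlt' : n < 3 := by exact_mod_cast hlt
  obtain rfl | rfl : n = 1 ∨ n = 2 := by omega
  all_goals norm_num

/-- Let `G` be a finite subgroup of `SL(3,ℂ)` consisting of diagonal
matrices, with ages defined via `g j j = exp(2πi·a g j)`, `a g j ∈ ℚ ∩ [0,1)`.  For
`i = 1,2,3` let `n i` be the cardinality of `K i = {g ∈ G : g i i = 1}`, and let `j_G` be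
the number of `g ∈ G` with `age g = 1` and no diagonal entry equal to `1`.  Then
`|G| = 1 + 2·j_G + Σᵢ (n i - 1)`. -/
theorem card_group_eq_one_add_two_jG_add_sum
    (G : Subgroup (Matrix.SpecialLinearGroup (Fin 3) ℂ)) [Fintype G]
    (hdiag : ∀ g ∈ G, (g : Matrix (Fin 3) (Fin 3) ℂ).IsDiag)
    (a : G → Fin 3 → ℚ)
    (ha0 : ∀ g j, 0 ≤ a g j) (ha1 : ∀ g j, a g j < 1)
    (hrep : ∀ (g : G) (j : Fin 3),
      ((g : Matrix.SpecialLinearGroup (Fin 3) ℂ) : Matrix (Fin 3) (Fin 3) ℂ) j j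
        = Complex.exp (2 * Real.pi * Complex.I * (a g j : ℂ))) :
    Nat.card G
      = 1 + 2 * Nat.card {g : G // (∑ j, a g j) = 1 ∧
            ∀ i : Fin 3,
              ((g : Matrix.SpecialLinearGroup (Fin 3) ℂ) : Matrix (Fin 3) (Fin 3) ℂ) i i ≠ 1}
        + ∑ i : Fin 3,
            (Nat.card {g : G //
              ((g : Matrix.SpecialLinearGroup (Fin 3) ℂ) : Matrix (Fin 3) (Fin 3) ℂ) i i = 1} - 1) := by
  classical
  have hone : ∀ (g : G) (j : Fin 3),
      ((g : Matrix.SpecialLinearGroup (Fin 3) ℂ) : Matrix (Fin 3) (Fin 3) ℂ) j j = 1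
        ↔ a g j = 0 := by
    intro g j
    rw [hrep, exp_two_pi_I_mul_ratCast_eq_one_iff]
    exact ⟨fun ⟨n, hn⟩ => eq_zero_of_eq_intCast (ha0 g j) (ha1 g j) hn, fun h => ⟨0, by simp [h]⟩⟩
  have hsum : ∀ g : G, ∃ n : ℤ, ∑ j, a g j = n := by
    intro g
    rw [← exp_two_pi_I_mul_ratCast_eq_one_iff, Rat.cast_sum, Finset.mul_sum, Complex.exp_sum]
    simp only [← hrep]
    rw [← Matrix.det_diagonal]
    have hd := (hdiag g g.2).diagonal_diag
    change (Matrix.diagonal (Matrix.diag (g : Matrix.SpecialLinearGroup (Fin 3) ℂ).1)).det = 1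
    rw [hd]
    exact (g : Matrix.SpecialLinearGroup (Fin 3) ℂ).2
  have hinv : ∀ (g : G) (j : Fin 3), ∃ n : ℤ, a g j + a g⁻¹ j = n := by
    intro g j
    rw [← exp_two_pi_I_mul_ratCast_eq_one_iff, Rat.cast_add, mul_add, Complex.exp_add, ← hrep,
      ← hrep]
    have hm : ((g : Matrix.SpecialLinearGroup (Fin 3) ℂ) : Matrix (Fin 3) (Fin 3) ℂ)
        * ((g⁻¹ : G) : Matrix.SpecialLinearGroup (Fin 3) ℂ).1 = 1 := by
      rw [← Matrix.SpecialLinearGroup.coe_mul, ← Subgroup.coe_mul, mul_inv_cancel]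
      simp
    have hjj := congrFun (congrFun hm j) j
    rw [Matrix.mul_apply, Matrix.one_apply_eq, Finset.sum_eq_single j] at hjj
    · exact hjj
    · intro k _ hk
      rw [hdiag g g.2 hk.symm, zero_mul]
    · simp
  have hinv_eq : ∀ (g : G) (j : Fin 3), a g j ≠ 0 → a g⁻¹ j = 1 - a g j := by
    intro g j hj
    obtain ⟨n, hn⟩ := hinv g j
    have hp : (0 : ℚ) < n := by
      rw [← hn]
      linarith [lt_of_le_of_ne (ha0 g j) hj.symm, ha0 g⁻¹ j]
    have hl : (n : ℚ) < 2 := by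
      rw [← hn]
      linarith [ha1 g j, ha1 g⁻¹ j]
    have hp' : 0 < n := by exact_mod_cast hp
    have hl' : n < 2 := by exact_mod_cast hl
    obtain rfl : n = 1 := by omega
    push_cast at hn
    linarith
  have heq_one : ∀ g : G, a g = 0 ↔ g = 1 := by
    intro g
    constructor
    · intro h
      ext i j
      by_cases hij : i = j
      · subst hij
        rw [(hone g i).2 (congrFun h i)]
        simp
      · rw [hdiag g g.2 hij]
        simp [Matrix.one_apply_ne hij]
    · rintro rfl
      funext j
      exact (hone 1 j).1 (by simp)
  have hdual : ∀ (g : G) (r s : ℚ), r + s = 3 → (∑ j, a g j = r ∧ ∀ i, a g i ≠ 0) →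
      ∑ j, a g⁻¹ j = s ∧ ∀ i, a g⁻¹ i ≠ 0 := by
    rintro g r s hrs ⟨h, hi⟩
    have he := fun j => hinv_eq g j (hi j)
    constructor
    · simp only [he, Fin.sum_univ_three] at h ⊢
      linarith
    · intro i
      rw [he]
      linarith [ha1 g i]
  have hflip : (∑ g : G, if ∑ j, a g j = 2 ∧ ∀ i, a g i ≠ 0 then (1 : ℤ) else 0)
      = ∑ g : G, if ∑ j, a g j = 1 ∧ ∀ i, a g i ≠ 0 then (1 : ℤ) else 0 := by
    refine Fintype.sum_equiv (Equiv.inv G) _ _ fun g => ?_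
    have hiff : (∑ j, a g j = 2 ∧ ∀ i, a g i ≠ 0)
        ↔ (∑ j, a g⁻¹ j = 1 ∧ ∀ i, a g⁻¹ i ≠ 0) :=
      ⟨hdual g 2 1 (by norm_num), fun h => by simpa using hdual g⁻¹ 1 2 (by norm_num) h⟩
    simp only [Equiv.inv_apply, hiff]
  have hcount : ∑ _g : G, (1 : ℤ) = _ := Finset.sum_congr rfl fun g _ =>
    indicator_count_of_sum_eq_intCast (ha0 g) (ha1 g) (hsum g).choose_spec
  have hid : (∑ g : G, if a g = 0 then (1 : ℤ) else 0) = 1 := by simp [heq_one]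
  simp only [Finset.sum_add_distrib] at hcount
  rw [Finset.sum_comm, hflip, hid] at hcount
  simp only [Finset.sum_sub_distrib, hid] at hcount
  have hpos : ∀ i : Fin 3, 1 ≤ Fintype.card {g : G // a g i = 0} := fun i =>
    Fintype.card_pos_iff.2 ⟨⟨1, congrFun ((heq_one 1).2 rfl) i⟩⟩
  simp only [ne_eq, hone, Nat.card_eq_fintype_card]
  zify
  simp only [Nat.cast_sub (hpos _), Nat.cast_one]
  simp only [Fintype.card_subtype, Finset.card_filter, Nat.cast_sum, Nat.cast_ite, Nat.cast_one,
    Nat.cast_zero]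
  simp only [Finset.sum_const, Finset.card_univ, nsmul_eq_mul, mul_one, ne_eq] at hcount
  simp only [Finset.sum_sub_distrib, Finset.sum_const, Finset.card_univ, nsmul_eq_mul, mul_one]
    at hcount ⊢
  linarith
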